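/- (Lemma 2 of the paper.) Fix a real constant a > 0 and a Borel probability measure μ on ℝ with μ({s : s² > ε}) > 0 for some ε > 0. Define the Bellman iterates V₀, V₁, V₂, … : [0, ∞) → ℝ by V₀(z) = 0 and V_m(z) = min{a z, 1 + ∫_ℝ V_{m−1}(z/(1 + z s²)) dμ(s)} for m ≥ 1. Then the pointwise limit V(z) = lim_{m→∞} V_m(z) exists for every z ≥ 0, and both the optimal cost function V and the expected sampling cost G(z) = 1 + ∫_ℝ V(z/(1 + z s²)) dμ(s) are non-decreasing, concave and bounded functions on [0, ∞). -/

import Mathlib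

open Set MeasureTheory Filter

/-- The Bellman iterates `V₀(z) = 0`,
`V_m(z) = min{az, 1 + ∫ V_{m−1}(z/(1 + zs²)) dμ(s)}`. -/
noncomputable def bellmanIter (a : ℝ) (μ : Measure ℝ) : ℕ → ℝ → ℝ
  | 0 => fun _ => 0
  | m + 1 => fun z =>
      min (a * z) (1 + ∫ s, bellmanIter a μ m (z / (1 + z * s ^ 2)) ∂μ)

/-- The expected sampling cost `G(z) = 1 + ∫ V(z/(1 + zs²)) dμ(s)`. -/
noncomputable def samplingCost (μ : Measure ℝ) (V : ℝ → ℝ) : ℝ → ℝ :=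
  fun z => 1 + ∫ s, V (z / (1 + z * s ^ 2)) ∂μ

/-- The map `z ↦ z / (1 + z * t)` is concave on `[0, ∞)` for `t ≥ 0`. -/
theorem concaveOn_div_one_add_mul {t : ℝ} (ht : 0 ≤ t) :
    ConcaveOn ℝ (Ici (0 : ℝ)) fun z => z / (1 + z * t) := by
  refine ⟨convex_Ici 0, fun x hx y hy α β hα hβ hαβ => ?_⟩
  simp only [mem_Ici, smul_eq_mul] at *
  have h1 : 0 < 1 + x * t := by positivity
  have h2 : 0 < 1 + y * t := by positivity
  have h3 : 0 < 1 + (α * x + β * y) * t := by positivity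
  have key : (α * x + β * y) / (1 + (α * x + β * y) * t)
      - (α * (x / (1 + x * t)) + β * (y / (1 + y * t)))
      = α * β * t * (x - y) ^ 2 /
        ((1 + (α * x + β * y) * t) * (1 + x * t) * (1 + y * t)) := by
    obtain rfl : α = 1 - β := by linarith
    field_simp
    ring
  have : 0 ≤ α * β * t * (x - y) ^ 2 /
        ((1 + (α * x + β * y) * t) * (1 + x * t) * (1 + y * t)) := by positivity
  linarith

/-- The map `z ↦ z / (1 + z * t)` is non-decreasing on `[0, ∞)` for `t ≥ 0`. -/
theorem monotoneOn_div_one_add_mul {t : ℝ} (ht : 0 ≤ t) :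
    MonotoneOn (fun z : ℝ => z / (1 + z * t)) (Ici (0 : ℝ)) := by
  intro x hx y hy hxy
  simp only [mem_Ici] at *
  rw [div_le_div_iff₀ (by positivity) (by positivity)]
  nlinarith

theorem div_one_add_mul_sq_nonneg {z : ℝ} (hz : 0 ≤ z) (s : ℝ) :
    0 ≤ z / (1 + z * s ^ 2) := by
  positivity

theorem div_one_add_mul_sq_le {z : ℝ} (hz : 0 ≤ z) (s : ℝ) :
    z / (1 + z * s ^ 2) ≤ z :=
  div_le_self hz (le_add_of_nonneg_right (by positivity))

/-- The properties of a cost function on `[0, ∞)` that are preserved by the Bellman recursion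
and by pointwise limits. -/
structure IsRegularCost (a : ℝ) (V : ℝ → ℝ) : Prop where
  nonneg : ∀ z, 0 ≤ z → 0 ≤ V z
  le_mul : ∀ z, 0 ≤ z → V z ≤ a * z
  mono : MonotoneOn V (Ici (0 : ℝ))
  concave : ConcaveOn ℝ (Ici (0 : ℝ)) V

namespace IsRegularCost

variable {a : ℝ} {V : ℝ → ℝ} {μ : Measure ℝ}

theorem integrable [IsFiniteMeasure μ] (hV : IsRegularCost a V) {z : ℝ} (hz : 0 ≤ z) :
    Integrable (fun s => V (z / (1 + z * s ^ 2))) μ := by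
  have hmeas : Measurable fun x => V (max x 0) :=
    Monotone.measurable fun x y hxy =>
      hV.mono (le_max_right x 0) (le_max_right y 0) (max_le_max_right 0 hxy)
  have hcomp : Measurable fun s : ℝ => V (z / (1 + z * s ^ 2)) := by
    convert hmeas.comp (g := fun x => V (max x 0))
      (f := fun s : ℝ => z / (1 + z * s ^ 2)) (by fun_prop) using 2 with s
    simp [max_eq_left (div_one_add_mul_sq_nonneg hz s)]
  refine Integrable.of_bound hcomp.aestronglyMeasurable (V z) (Eventually.of_forall fun s => ?_)
  have h0 := div_one_add_mul_sq_nonneg hz s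
  rw [Real.norm_of_nonneg (hV.nonneg _ h0)]
  exact hV.mono h0 hz (div_one_add_mul_sq_le hz s)

theorem samplingCost_nonneg (hV : IsRegularCost a V) {z : ℝ} (hz : 0 ≤ z) :
    0 ≤ samplingCost μ V z :=
  add_nonneg zero_le_one
    (integral_nonneg fun s => hV.nonneg _ (div_one_add_mul_sq_nonneg hz s))

theorem monotoneOn_samplingCost [IsFiniteMeasure μ] (hV : IsRegularCost a V) :
    MonotoneOn (samplingCost μ V) (Ici (0 : ℝ)) := by
  intro x hx y hy hxy
  refine add_le_add le_rfl (integral_mono (hV.integrable hx) (hV.integrable hy) fun s => ?_)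
  exact hV.mono (div_one_add_mul_sq_nonneg hx s) (div_one_add_mul_sq_nonneg hy s)
    (monotoneOn_div_one_add_mul (sq_nonneg s) hx hy hxy)

theorem concaveOn_samplingCost [IsFiniteMeasure μ] (hV : IsRegularCost a V) :
    ConcaveOn ℝ (Ici (0 : ℝ)) (samplingCost μ V) := by
  refine ⟨convex_Ici 0, fun x hx y hy α β hα hβ hαβ => ?_⟩
  have hxy : α • x + β • y ∈ Ici (0 : ℝ) := convex_Ici 0 hx hy hα hβ hαβ
  have hle : ∫ s, (α * V (x / (1 + x * s ^ 2)) + β * V (y / (1 + y * s ^ 2))) ∂μ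
      ≤ ∫ s, V ((α • x + β • y) / (1 + (α • x + β • y) * s ^ 2)) ∂μ := by
    refine integral_mono (((hV.integrable hx).const_mul α).add ((hV.integrable hy).const_mul β))
      (hV.integrable hxy) fun s => ?_
    have hx' : x / (1 + x * s ^ 2) ∈ Ici (0 : ℝ) := div_one_add_mul_sq_nonneg hx s
    have hy' : y / (1 + y * s ^ 2) ∈ Ici (0 : ℝ) := div_one_add_mul_sq_nonneg hy s
    exact (hV.concave.2 hx' hy' hα hβ hαβ).trans
      (hV.mono (convex_Ici 0 hx' hy' hα hβ hαβ) (div_one_add_mul_sq_nonneg hxy s)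
        ((concaveOn_div_one_add_mul (sq_nonneg s)).2 hx hy hα hβ hαβ))
  rw [integral_add ((hV.integrable hx).const_mul α) ((hV.integrable hy).const_mul β),
    integral_const_mul, integral_const_mul] at hle
  simp only [samplingCost, smul_eq_mul] at *
  linarith

theorem min_samplingCost [IsFiniteMeasure μ] (ha : 0 ≤ a) (hV : IsRegularCost a V) :
    IsRegularCost a fun z => min (a * z) (samplingCost μ V z) where
  nonneg _ hz := le_min (mul_nonneg ha hz) (hV.samplingCost_nonneg hz)
  le_mul _ _ := min_le_left _ _
  mono _ hx _ hy hxy :=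
    min_le_min (mul_le_mul_of_nonneg_left hxy ha) (hV.monotoneOn_samplingCost hx hy hxy)
  concave := ((LinearMap.mul ℝ ℝ a).concaveOn (convex_Ici 0)).inf hV.concaveOn_samplingCost

theorem of_tendsto {U : ℕ → ℝ → ℝ} (hU : ∀ m, IsRegularCost a (U m))
    (hlim : ∀ z, 0 ≤ z → Tendsto (fun m => U m z) atTop (nhds (V z))) :
    IsRegularCost a V where
  nonneg z hz := ge_of_tendsto' (hlim z hz) fun m => (hU m).nonneg z hz
  le_mul z hz := le_of_tendsto' (hlim z hz) fun m => (hU m).le_mul z hz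
  mono x hx y hy hxy :=
    le_of_tendsto_of_tendsto' (hlim x hx) (hlim y hy) fun m => (hU m).mono hx hy hxy
  concave := ⟨convex_Ici 0, fun x hx y hy α β hα hβ hαβ =>
    le_of_tendsto_of_tendsto' (((hlim x hx).const_smul α).add ((hlim y hy).const_smul β))
      (hlim _ (convex_Ici 0 hx hy hα hβ hαβ)) fun m => (hU m).concave.2 hx hy hα hβ hαβ⟩

/-- A bound `V ≤ 1 / p + a / ε`, where `p` is the probability of `ε < s ^ 2`, passes to the
sampling cost: off that event the bound is inherited, on it the next cost is at most `a / ε`. -/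
theorem samplingCost_le [IsProbabilityMeasure μ] (ha : 0 ≤ a) (hV : IsRegularCost a V)
    {ε : ℝ} (hε : 0 < ε) (hpos : 0 < μ {s : ℝ | ε < s ^ 2})
    (hbound : ∀ z, 0 ≤ z → V z ≤ 1 / μ.real {s : ℝ | ε < s ^ 2} + a / ε)
    {z : ℝ} (hz : 0 ≤ z) :
    samplingCost μ V z ≤ 1 / μ.real {s : ℝ | ε < s ^ 2} + a / ε := by
  have hp : 0 < μ.real {s : ℝ | ε < s ^ 2} := ENNReal.toReal_pos hpos.ne' (measure_ne_top _ _)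
  have hA : MeasurableSet {s : ℝ | ε < s ^ 2} :=
    measurableSet_lt measurable_const (by fun_prop)
  set A := {s : ℝ | ε < s ^ 2}
  set p := μ.real A
  have hind : Integrable (A.indicator fun _ => -(1 / p)) μ :=
    (integrable_const _).indicator hA
  have hle : ∫ s, V (z / (1 + z * s ^ 2)) ∂μ
      ≤ ∫ s, (A.indicator (fun _ => -(1 / p)) s + (1 / p + a / ε)) ∂μ := by
    refine integral_mono (hV.integrable hz) (hind.add (integrable_const _)) fun s => ?_
    have h0 := div_one_add_mul_sq_nonneg hz s
    by_cases hs : s ∈ A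
    · have hs' : ε < s ^ 2 := hs
      have hstep : z / (1 + z * s ^ 2) ≤ 1 / ε := by
        rw [div_le_div_iff₀ (by positivity) hε]
        nlinarith
      have hmul := mul_le_mul_of_nonneg_left hstep ha
      rw [mul_one_div] at hmul
      simpa [indicator_of_mem hs] using (hV.le_mul _ h0).trans hmul
    · simpa [indicator_of_notMem hs] using hbound _ h0
  rw [integral_add hind (integrable_const _), integral_indicator_const _ hA, integral_const,
    probReal_univ, smul_eq_mul, smul_eq_mul, one_mul, mul_neg, mul_one_div_cancel hp.ne'] at hle
  unfold samplingCost
  linarith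

end IsRegularCost

theorem bellmanIter_succ (a : ℝ) (μ : Measure ℝ) (m : ℕ) :
    bellmanIter a μ (m + 1) =
      fun z => min (a * z) (samplingCost μ (bellmanIter a μ m) z) :=
  rfl

theorem isRegularCost_bellmanIter {a : ℝ} (ha : 0 ≤ a) (μ : Measure ℝ) [IsFiniteMeasure μ]
    (m : ℕ) : IsRegularCost a (bellmanIter a μ m) := by
  induction m with
  | zero =>
    exact ⟨fun _ _ => le_rfl, fun z hz => mul_nonneg ha hz, fun _ _ _ _ _ => le_rfl,
      concaveOn_const 0 (convex_Ici 0)⟩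
  | succ m ih => exact ih.min_samplingCost ha

theorem bellmanIter_le_succ {a : ℝ} (ha : 0 ≤ a) (μ : Measure ℝ) [IsFiniteMeasure μ]
    (m : ℕ) : ∀ z, 0 ≤ z → bellmanIter a μ m z ≤ bellmanIter a μ (m + 1) z := by
  induction m with
  | zero => exact (isRegularCost_bellmanIter ha μ 1).nonneg
  | succ m ih =>
    intro z hz
    refine min_le_min le_rfl (add_le_add le_rfl (integral_mono
      ((isRegularCost_bellmanIter ha μ m).integrable hz)
      ((isRegularCost_bellmanIter ha μ (m + 1)).integrable hz) fun s => ?_))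
    exact ih _ (div_one_add_mul_sq_nonneg hz s)

theorem bellmanIter_le {a : ℝ} (ha : 0 ≤ a) (μ : Measure ℝ) [IsProbabilityMeasure μ]
    {ε : ℝ} (hε : 0 < ε) (hpos : 0 < μ {s : ℝ | ε < s ^ 2}) (m : ℕ) :
    ∀ z, 0 ≤ z → bellmanIter a μ m z ≤ 1 / μ.real {s : ℝ | ε < s ^ 2} + a / ε := by
  induction m with
  | zero => exact fun z _ => by simp only [bellmanIter]; positivity
  | succ m ih =>
    exact fun z hz => (min_le_right _ _).trans
      ((isRegularCost_bellmanIter ha μ m).samplingCost_le ha hε hpos ih hz)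

/-- Lemma 2 of the paper: the pointwise limit `V` of the Bellman iterates exists, and
both the optimal cost `V` and the expected sampling cost
`G(z) = 1 + ∫ V(z/(1 + zs²)) dμ(s)` are non-decreasing, concave and bounded
on `[0, ∞)`. -/
theorem optimal_cost_monotone_concave_bounded (a : ℝ) (ha : 0 < a)
    (μ : Measure ℝ) [IsProbabilityMeasure μ]
    (ε : ℝ) (hε : 0 < ε) (hpos : 0 < μ {s : ℝ | ε < s ^ 2}) :
    ∃ V : ℝ → ℝ,
      (∀ z : ℝ, 0 ≤ z →
        Tendsto (fun m => bellmanIter a μ m z) atTop (nhds (V z))) ∧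
      MonotoneOn V (Ici (0 : ℝ)) ∧
      ConcaveOn ℝ (Ici (0 : ℝ)) V ∧
      (∃ c : ℝ, ∀ z : ℝ, 0 ≤ z → |V z| ≤ c) ∧
      MonotoneOn (samplingCost μ V) (Ici (0 : ℝ)) ∧
      ConcaveOn ℝ (Ici (0 : ℝ)) (samplingCost μ V) ∧
      (∃ c : ℝ, ∀ z : ℝ, 0 ≤ z → |samplingCost μ V z| ≤ c) := by
  have hreg := isRegularCost_bellmanIter ha.le μ
  have hbound := bellmanIter_le ha.le μ hε hpos
  set C := 1 / μ.real {s : ℝ | ε < s ^ 2} + a / ε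
  have hlim (z : ℝ) (hz : 0 ≤ z) : Tendsto (fun m => bellmanIter a μ m z) atTop
      (nhds (⨆ m, bellmanIter a μ m z)) :=
    tendsto_atTop_ciSup (monotone_nat_of_le_succ fun m => bellmanIter_le_succ ha.le μ m z hz)
      ⟨C, forall_mem_range.2 fun m => hbound m z hz⟩
  have hV := IsRegularCost.of_tendsto hreg hlim
  have hVle (z : ℝ) (hz : 0 ≤ z) : ⨆ m, bellmanIter a μ m z ≤ C :=
    le_of_tendsto' (hlim z hz) fun m => hbound m z hz
  refine ⟨_, hlim, hV.mono, hV.concave, ⟨C, fun z hz => ?_⟩,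
    hV.monotoneOn_samplingCost, hV.concaveOn_samplingCost, ⟨C, fun z hz => ?_⟩⟩
  · rw [abs_of_nonneg (hV.nonneg z hz)]
    exact hVle z hz
  · rw [abs_of_nonneg (hV.samplingCost_nonneg hz)]
    exact hV.samplingCost_le ha.le hε hpos hVle hz
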